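/- arXiv:2004.14663 — 3 statements merged into one kernel-verified Lean document; each statement's English description precedes it below -/
import Mathlib

section
/- Let O_m, O_n, ν, u be Pauli strings on N qubits such that Tr(O_nᴴ [O_m, ν]) ≠ 0 and Tr(O_nᴴ [O_m, u]) ≠ 0. Then ν = u. Consequently, between any two vertices of the graph associated with an accessible set there is at most one edge, and its edging-operator label is unique (the graph has no multiple edges). -/
open Matrix Complex Kronecker
open scoped Classical

noncomputable section

/-- The state/operator space of an `N`-qubit system, indexed by bit strings. -/
abbrev Mat (N : ℕ) := Matrix (Fin N → Fin 2) (Fin N → Fin 2) ℂ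

/-- The four Pauli matrices: σ₀ = I, σ₁ = X, σ₂ = Y, σ₃ = Z. -/
def pauli (a : Fin 4) : Matrix (Fin 2) (Fin 2) ℂ :=
  if a = 0 then 1
  else if a = 1 then !![0, 1; 1, 0]
  else if a = 2 then !![0, -Complex.I; Complex.I, 0]
  else !![1, 0; 0, -1]

/-- The Pauli string σ_{s 1} ⊗ σ_{s 2} ⊗ ⋯ ⊗ σ_{s N}, realized entrywise. -/
def pauliString {N : ℕ} (s : Fin N → Fin 4) : Mat N :=
  fun i j => ∏ k, pauli (s k) (i k) (j k)

/-- Ω : the set of all Pauli strings on `N` qubits. -/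
def Omega (N : ℕ) : Set (Mat N) := Set.range pauliString

/-- The commutator [A,B] = AB − BA. -/
def mcomm {n : Type*} [Fintype n] (A B : Matrix n n ℂ) : Matrix n n ℂ := A * B - B * A

/-- ⌊A,B⌉ : the unique Pauli string which is a nonzero scalar multiple of [A,B];
it is 0 when no such Pauli string exists (in particular when [A,B] = 0). -/
def pbracket {N : ℕ} (A B : Mat N) : Mat N :=
  if h : ∃ s : Fin N → Fin 4, ∃ c : ℂ, c ≠ 0 ∧ mcomm A B = c • pauliString s
  then pauliString h.choose else 0

/-- The accessible set f(Ω, F, M) : the smallest set containing M and closed under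
adding ⌊τ,ν⌉ for τ already accessible, ν ∈ F with [τ,ν] ≠ 0. -/
inductive Accessible {N : ℕ} (F M : Set (Mat N)) : Mat N → Prop
  | base {O : Mat N} : O ∈ M → Accessible F M O
  | step {τ ν : Mat N} : Accessible F M τ → ν ∈ F → mcomm τ ν ≠ 0 →
      Accessible F M (pbracket τ ν)

/-- The accessible set, as a set. -/
def accSet {N : ℕ} (F M : Set (Mat N)) : Set (Mat N) := {O | Accessible F M O}

/-- Adjacency in the graph with vertex set S, relative to the Hamiltonian set F:
distinct vertices O_m, O_n are adjacent iff Tr(O_nᴴ [O_m, ν]) ≠ 0 for some ν ∈ F. -/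
def Adj {N : ℕ} (F S : Set (Mat N)) (A B : Mat N) : Prop :=
  A ∈ S ∧ B ∈ S ∧ A ≠ B ∧ ∃ ν ∈ F, (Bᴴ * mcomm A ν).trace ≠ 0

/-- Connectivity of the graph on vertex set S: any two vertices are joined by a path. -/
def GraphConnected {N : ℕ} (F S : Set (Mat N)) : Prop :=
  ∀ A ∈ S, ∀ B ∈ S, Relation.ReflTransGen (Adj F S) A B

/-- Index string with value `a` at 0-indexed positions k and k+1, identity elsewhere. -/
def twoSite (N k : ℕ) (a : Fin 4) : Fin N → Fin 4 :=
  fun j => if (j : ℕ) = k ∨ (j : ℕ) = k + 1 then a else 0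

/-- Chain Hamiltonian set F̄_K = {X_jX_{j+1}, Y_jY_{j+1} : 1 ≤ j ≤ K−1 } (1-indexed),
i.e., couplings on 0-indexed positions (t, t+1) with t+1 < K. -/
def chainFk (N K : ℕ) : Set (Mat N) :=
  {O | ∃ t : ℕ, t + 1 < K ∧
    (O = pauliString (twoSite N t 1) ∨ O = pauliString (twoSite N t 2))}

/-- The full chain Hamiltonian set on N qubits. -/
def chainF (N : ℕ) : Set (Mat N) := chainFk N N

/-- Single-site Pauli string: `a` at 0-indexed position k, identity elsewhere. -/
def singleSite (N k : ℕ) (a : Fin 4) : Fin N → Fin 4 :=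
  fun j => if (j : ℕ) = k then a else 0

/-- Z on 0-indexed positions 0,…,m−1, `a` at position m, identity elsewhere. -/
def zTail (N m : ℕ) (a : Fin 4) : Fin N → Fin 4 :=
  fun j => if (j : ℕ) < m then 3 else if (j : ℕ) = m then a else 0

/-- A Pauli string is k-finite (k is 1-indexed) when its k-th factor is not the
identity and all factors beyond position k are the identity. -/
def kFinite {N : ℕ} (k : ℕ) (O : Mat N) : Prop :=
  ∃ s : Fin N → Fin 4, O = pauliString s ∧
    (∀ j : Fin N, (j : ℕ) + 1 = k → s j ≠ 0) ∧
    (∀ j : Fin N, k ≤ (j : ℕ) → s j = 0)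

/-- Path along an edging sequence E: iteratively applying O ↦ ⌊O,ν⌉ along E has
every intermediate commutator nonzero and ends at the indicated operator. -/
def IsPath {N : ℕ} : Mat N → List (Mat N) → Mat N → Prop
  | A, [], B => A = B
  | A, n :: E, B => mcomm A n ≠ 0 ∧ IsPath (pbracket A n) E B

/-- G_{⌊k} : equal to G_1 when k = 1 and to G_k \ G_{k−1} when k > 1. -/
def Gfloor {N : ℕ} (M : Set (Mat N)) (k : ℕ) : Set (Mat N) :=
  if k = 1 then accSet (chainFk N 1) M
  else accSet (chainFk N k) M \ accSet (chainFk N (k - 1)) M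

/-- G¹_{⌊k+1} : the operators in G_{⌊k+1} adjacent, in the graph of G_{k+1},
to some element of G_k. -/
def G1floor {N : ℕ} (M : Set (Mat N)) (k : ℕ) : Set (Mat N) :=
  {O | O ∈ Gfloor M (k + 1) ∧
    ∃ P ∈ accSet (chainFk N k) M,
      Adj (chainFk N (k + 1)) (accSet (chainFk N (k + 1)) M) P O}

/-- The Kronecker product of a family of matrices, realized entrywise on tuples of indices. -/
def piKronecker {ι n R : Type*} [Fintype ι] [CommSemiring R] (A : ι → Matrix n n R) :
    Matrix (ι → n) (ι → n) R :=
  fun i j => ∏ k, A k (i k) (j k)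

theorem piKronecker_mul {ι n R : Type*} [Fintype ι] [DecidableEq ι] [Fintype n] [CommSemiring R]
    (A B : ι → Matrix n n R) :
    piKronecker A * piKronecker B = piKronecker fun k => A k * B k := by
  ext i j
  simp only [piKronecker, Matrix.mul_apply, Finset.prod_univ_sum, Fintype.piFinset_univ,
    Finset.prod_mul_distrib]

theorem conjTranspose_piKronecker {ι n R : Type*} [Fintype ι] [CommSemiring R] [StarRing R]
    (A : ι → Matrix n n R) : (piKronecker A)ᴴ = piKronecker fun k => (A k)ᴴ := by
  ext i j
  simp [piKronecker, Matrix.conjTranspose_apply, star_prod]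

theorem trace_piKronecker {ι n R : Type*} [Fintype ι] [DecidableEq ι] [Fintype n] [CommSemiring R]
    (A : ι → Matrix n n R) : (piKronecker A).trace = ∏ k, (A k).trace := by
  simp only [piKronecker, Matrix.trace, Matrix.diag_apply, Finset.prod_univ_sum,
    Fintype.piFinset_univ]

theorem trace_pauliString_mul {N : ℕ} (a b c : Fin N → Fin 4) :
    ((pauliString a)ᴴ * (pauliString b * pauliString c)).trace =
      ∏ k, ((pauli (a k))ᴴ * (pauli (b k) * pauli (c k))).trace := by
  have eq_piKronecker (s : Fin N → Fin 4) : pauliString s = piKronecker fun k => pauli (s k) := rfl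
  simp only [eq_piKronecker]
  rw [conjTranspose_piKronecker, piKronecker_mul, piKronecker_mul, trace_piKronecker]

theorem eq_xor_of_trace_pauli_mul_ne_zero (a b c : Fin 4)
    (h : ((pauli a)ᴴ * (pauli b * pauli c)).trace ≠ 0) : c = a ^^^ b := by
  contrapose! h
  fin_cases a <;> fin_cases b <;> fin_cases c <;>
    first
    | exact absurd (by decide) h
    | simp [pauli, Matrix.trace_fin_two, Matrix.mul_apply, Fin.sum_univ_two]

theorem eq_xor_of_trace_mcomm_ne_zero {N : ℕ} (a b c : Fin N → Fin 4)
    (h : ((pauliString a)ᴴ * mcomm (pauliString b) (pauliString c)).trace ≠ 0) (k : Fin N) :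
    c k = a k ^^^ b k := by
  rw [mcomm, Matrix.mul_sub, Matrix.trace_sub, trace_pauliString_mul, trace_pauliString_mul] at h
  by_cases hbc : ∏ k, ((pauli (a k))ᴴ * (pauli (b k) * pauli (c k))).trace = 0
  · rw [hbc, zero_sub, neg_ne_zero, Finset.prod_ne_zero_iff] at h
    have hb := eq_xor_of_trace_pauli_mul_ne_zero _ _ _ (h k (Finset.mem_univ k))
    have xor_cancel : ∀ x y z : Fin 4, y = x ^^^ z → z = x ^^^ y := by decide
    exact xor_cancel _ _ _ hb
  · rw [← ne_eq, Finset.prod_ne_zero_iff] at hbc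
    exact eq_xor_of_trace_pauli_mul_ne_zero _ _ _ (hbc k (Finset.mem_univ k))

theorem stmt_5 {N : ℕ} (Om On ν u : Mat N) (h1 : Om ∈ Omega N) (h2 : On ∈ Omega N)
    (h3 : ν ∈ Omega N) (h4 : u ∈ Omega N)
    (hν : (Onᴴ * mcomm Om ν).trace ≠ 0) (hu : (Onᴴ * mcomm Om u).trace ≠ 0) :
    ν = u := by
  obtain ⟨b, rfl⟩ := h1
  obtain ⟨a, rfl⟩ := h2
  obtain ⟨c, rfl⟩ := h3
  obtain ⟨d, rfl⟩ := h4
  congr 1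
  funext k
  rw [eq_xor_of_trace_mcomm_ne_zero a b c hν k, eq_xor_of_trace_mcomm_ne_zero a b d hu k]
end
end

section
/- Let F̄ ⊆ Ω and M̄ ⊆ Ω, let G = f(Ω, F̄, M̄) be the accessible set, let 𝔾 be the graph associated with G, and let 𝕄 be the induced subgraph of 𝔾 on the vertex set M̄. If 𝕄 is connected, then 𝔾 is connected. -/
open Matrix Complex Kronecker
open scoped Classical

noncomputable section

lemma pauli_isHermitian (a : Fin 4) : (pauli a).IsHermitian := by
  ext i j
  fin_cases a <;> fin_cases i <;> fin_cases j <;> simp [pauli]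

lemma exists_pauli_mul_pauli (a b : Fin 4) :
    ∃ (d : Fin 4) (c : ℂ), pauli a * pauli b = c • pauli d := by
  fin_cases a <;> fin_cases b
  · exact ⟨0, 1, by simp [pauli]⟩
  · exact ⟨1, 1, by simp [pauli]⟩
  · exact ⟨2, 1, by simp [pauli]⟩
  · exact ⟨3, 1, by simp [pauli]⟩
  · exact ⟨1, 1, by simp [pauli]⟩
  · exact ⟨0, 1, by simp [pauli, Matrix.one_fin_two]⟩
  · exact ⟨3, Complex.I, by simp [pauli]⟩
  · exact ⟨2, -Complex.I, by simp [pauli]⟩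
  · exact ⟨2, 1, by simp [pauli]⟩
  · exact ⟨3, -Complex.I, by simp [pauli]⟩
  · exact ⟨0, 1, by simp [pauli, Matrix.one_fin_two]⟩
  · exact ⟨1, Complex.I, by simp [pauli]⟩
  · exact ⟨3, 1, by simp [pauli]⟩
  · exact ⟨2, Complex.I, by simp [pauli]⟩
  · exact ⟨1, -Complex.I, by simp [pauli]⟩
  · exact ⟨0, 1, by simp [pauli, Matrix.one_fin_two]⟩

lemma isHermitian_of_mem_Omega {N : ℕ} {A : Mat N} (hA : A ∈ Omega N) : A.IsHermitian := by
  obtain ⟨s, rfl⟩ := hA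
  ext i j
  simp only [conjTranspose_apply, pauliString, star_prod]
  exact Finset.prod_congr rfl fun k _ => (pauli_isHermitian (s k)).apply (i k) (j k)

lemma exists_mul_eq_smul_of_mem_Omega {N : ℕ} {A B : Mat N} (hA : A ∈ Omega N)
    (hB : B ∈ Omega N) : ∃ P ∈ Omega N, ∃ c : ℂ, A * B = c • P := by
  obtain ⟨s, rfl⟩ := hA
  obtain ⟨t, rfl⟩ := hB
  choose d c h using fun k => exists_pauli_mul_pauli (s k) (t k)
  refine ⟨pauliString d, ⟨d, rfl⟩, ∏ k, c k, ?_⟩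
  ext i j
  have hk (k : Fin N) : ∑ x, pauli (s k) (i k) x * pauli (t k) x (j k)
      = c k * pauli (d k) (i k) (j k) := by
    rw [← Matrix.mul_apply, h k, Matrix.smul_apply, smul_eq_mul]
  simp only [Matrix.mul_apply, pauliString, Matrix.smul_apply, smul_eq_mul,
    ← Finset.prod_mul_distrib, ← hk, Finset.prod_univ_sum, Fintype.piFinset_univ]

lemma exists_mcomm_eq_smul_pbracket {N : ℕ} {A B : Mat N} (hA : A ∈ Omega N)
    (hB : B ∈ Omega N) (h : mcomm A B ≠ 0) :
    pbracket A B ∈ Omega N ∧ ∃ c : ℂ, c ≠ 0 ∧ mcomm A B = c • pbracket A B := by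
  have hex : ∃ s : Fin N → Fin 4, ∃ c : ℂ, c ≠ 0 ∧ mcomm A B = c • pauliString s := by
    obtain ⟨P, hP, c, hc⟩ := exists_mul_eq_smul_of_mem_Omega hA hB
    have hBA : B * A = star c • P := by
      have := congrArg conjTranspose hc
      rwa [conjTranspose_mul, conjTranspose_smul, isHermitian_of_mem_Omega hA,
        isHermitian_of_mem_Omega hB, isHermitian_of_mem_Omega hP] at this
    have hcomm : mcomm A B = (c - star c) • P := by rw [mcomm, hc, hBA, sub_smul]
    obtain ⟨s, rfl⟩ := hP
    refine ⟨s, c - star c, fun h0 => h ?_, hcomm⟩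
    rw [hcomm, h0, zero_smul]
  rw [pbracket, dif_pos hex]
  exact ⟨⟨_, rfl⟩, hex.choose_spec⟩

lemma trace_mul_mcomm_swap {n : Type*} [Fintype n] (A B C : Matrix n n ℂ) :
    (A * mcomm B C).trace = -(B * mcomm A C).trace := by
  have h₁ : (A * (B * C)).trace = (B * (C * A)).trace := by
    rw [Matrix.trace_mul_comm, Matrix.mul_assoc]
  have h₂ : (A * (C * B)).trace = (B * (A * C)).trace := by
    rw [← Matrix.mul_assoc, Matrix.trace_mul_comm]
  simp only [mcomm, Matrix.mul_sub, Matrix.trace_sub, h₁, h₂, neg_sub]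

lemma Adj.symm_of_subset_Omega {N : ℕ} {F S : Set (Mat N)} (hS : S ⊆ Omega N) {A B : Mat N}
    (h : Adj F S A B) : Adj F S B A := by
  obtain ⟨hA, hB, hne, ν, hν, ht⟩ := h
  refine ⟨hB, hA, hne.symm, ν, hν, ?_⟩
  rw [isHermitian_of_mem_Omega (hS hB)] at ht
  rwa [isHermitian_of_mem_Omega (hS hA), trace_mul_mcomm_swap, neg_ne_zero]

lemma accSet_subset_Omega {N : ℕ} {F M : Set (Mat N)} (hF : F ⊆ Omega N) (hM : M ⊆ Omega N) :
    accSet F M ⊆ Omega N := by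
  intro O hO
  induction hO with
  | base h => exact hM h
  | step _ hν hne ih => exact (exists_mcomm_eq_smul_pbracket ih (hF hν) hne).1

open scoped ComplexOrder in
lemma adj_pbracket {N : ℕ} {F S : Set (Mat N)} {A ν : Mat N} (hA : A ∈ S)
    (hAΩ : A ∈ Omega N) (hν : ν ∈ F) (hνΩ : ν ∈ Omega N) (hP : pbracket A ν ∈ S)
    (hne : mcomm A ν ≠ 0) : Adj F S A (pbracket A ν) := by
  obtain ⟨-, c, hc, hcomm⟩ := exists_mcomm_eq_smul_pbracket hAΩ hνΩ hne
  have htr : ((pbracket A ν)ᴴ * mcomm A ν).trace ≠ 0 := by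
    intro h
    rw [hcomm, Matrix.mul_smul, Matrix.trace_smul, smul_eq_zero_iff_right hc,
      Matrix.trace_conjTranspose_mul_self_eq_zero_iff] at h
    exact hne (by rw [hcomm, h, smul_zero])
  refine ⟨hA, hP, fun heq => htr ?_, ν, hν, htr⟩
  rw [← heq, isHermitian_of_mem_Omega hAΩ]
  exact self_eq_neg.mp (trace_mul_mcomm_swap A A ν)

lemma exists_reflTransGen_adj_of_mem_accSet {N : ℕ} {F M : Set (Mat N)} (hF : F ⊆ Omega N)
    (hM : M ⊆ Omega N) {O : Mat N} (hO : O ∈ accSet F M) :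
    ∃ A ∈ M, Relation.ReflTransGen (Adj F (accSet F M)) A O := by
  induction hO with
  | base h => exact ⟨_, h, .refl⟩
  | step hτ hν hne ih =>
    obtain ⟨A, hA, hpath⟩ := ih
    exact ⟨A, hA, hpath.tail (adj_pbracket hτ (accSet_subset_Omega hF hM hτ) hν (hF hν)
      (Accessible.step hτ hν hne) hne)⟩

lemma Adj.mono {N : ℕ} {F S T : Set (Mat N)} (hST : S ⊆ T) {A B : Mat N} (h : Adj F S A B) :
    Adj F T A B :=
  ⟨hST h.1, hST h.2.1, h.2.2⟩

theorem stmt_6 {N : ℕ} (F M : Set (Mat N)) (hF : F ⊆ Omega N) (hM : M ⊆ Omega N)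
    (hconn : GraphConnected F M) :
    GraphConnected F (accSet F M) := by
  intro A hA B hB
  obtain ⟨A', hA', hAA'⟩ := exists_reflTransGen_adj_of_mem_accSet hF hM hA
  obtain ⟨B', hB', hBB'⟩ := exists_reflTransGen_adj_of_mem_accSet hF hM hB
  have : Std.Symm (Adj F (accSet F M)) :=
    ⟨fun _ _ h => h.symm_of_subset_Omega (accSet_subset_Omega hF hM)⟩
  have hmid : Relation.ReflTransGen (Adj F (accSet F M)) A' B' :=
    Relation.ReflTransGen.mono (fun _ _ => Adj.mono fun _ => Accessible.base) _ _
      (hconn A' hA' B' hB')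
  exact ((symm hAA').trans hmid).trans hBB'
end
end

section
/- Let N ≥ 1 and let F̄ = { X_k X_{k+1}, Y_k Y_{k+1} : 1 ≤ k ≤ N−1 } be the chain Hamiltonian set on N qubits, and let the measurement set be M̄ = { Z_1 }. Then for every 1 ≤ k ≤ N, the Pauli string Z_k belongs to the accessible set f(Ω, F̄, M̄). (This follows iteratively from the identities ⌊Z_k, X_k X_{k+1}⌉ = Y_k X_{k+1} and ⌊Y_k X_{k+1}, Y_k Y_{k+1}⌉ = Z_{k+1}.) -/
open Matrix Complex Kronecker
open scoped Classical

noncomputable section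

/-- The Kronecker product of a family of `2 × 2` matrices, realized entrywise. -/
def tensorFamily {N : ℕ} (A : Fin N → Matrix (Fin 2) (Fin 2) ℂ) : Mat N :=
  fun i j => ∏ k, A k (i k) (j k)

theorem tensorFamily_mul {N : ℕ} (A B : Fin N → Matrix (Fin 2) (Fin 2) ℂ) :
    tensorFamily A * tensorFamily B = tensorFamily (fun k => A k * B k) := by
  ext i j
  simp only [tensorFamily, Matrix.mul_apply, Fintype.prod_sum, Finset.prod_mul_distrib]

theorem trace_tensorFamily {N : ℕ} (A : Fin N → Matrix (Fin 2) (Fin 2) ℂ) :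
    (tensorFamily A).trace = ∏ k, (A k).trace := by
  simp only [tensorFamily, Matrix.trace, Matrix.diag_apply, Fintype.prod_sum]

theorem tensorFamily_smul {N : ℕ} (c : Fin N → ℂ) (A : Fin N → Matrix (Fin 2) (Fin 2) ℂ) :
    tensorFamily (fun k => c k • A k) = (∏ k, c k) • tensorFamily A := by
  ext i j
  simp [tensorFamily, Finset.prod_mul_distrib]

theorem pauliString_eq_tensorFamily {N : ℕ} (s : Fin N → Fin 4) :
    pauliString s = tensorFamily (fun k => pauli (s k)) := rfl

theorem trace_pauli_mul_pauli (a b : Fin 4) :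
    (pauli a * pauli b).trace = if a = b then 2 else 0 := by
  fin_cases a <;> fin_cases b <;>
    simp [pauli, Matrix.trace_fin_two] <;> norm_num

theorem trace_pauliString_mul_s13 {N : ℕ} (s t : Fin N → Fin 4) :
    (pauliString s * pauliString t).trace = ∏ k, if s k = t k then (2 : ℂ) else 0 := by
  simp only [pauliString_eq_tensorFamily, tensorFamily_mul, trace_tensorFamily,
    trace_pauli_mul_pauli]

theorem pauliString_ne_zero {N : ℕ} (s : Fin N → Fin 4) : pauliString s ≠ 0 := by
  intro h
  have htr := trace_pauliString_mul_s13 s s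
  simp only [h, zero_mul, Matrix.trace_zero, if_true, Finset.prod_const] at htr
  exact pow_ne_zero _ two_ne_zero htr.symm

theorem eq_of_smul_pauliString_eq {N : ℕ} {s t : Fin N → Fin 4} {c d : ℂ} (hc : c ≠ 0)
    (h : c • pauliString s = d • pauliString t) : s = t := by
  have htr := congrArg (fun A => (pauliString s * A).trace) h
  simp only [Matrix.mul_smul, Matrix.trace_smul, trace_pauliString_mul_s13, smul_eq_mul] at htr
  have hne : (∏ k, if s k = t k then (2 : ℂ) else 0) ≠ 0 := by
    intro h0
    simp [h0, hc] at htr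
  funext k
  by_contra hk
  exact hne (Finset.prod_eq_zero (Finset.mem_univ k) (if_neg hk))

theorem pbracket_eq_pauliString {N : ℕ} {A B : Mat N} {s : Fin N → Fin 4} {c : ℂ} (hc : c ≠ 0)
    (h : mcomm A B = c • pauliString s) : pbracket A B = pauliString s := by
  have hex : ∃ s : Fin N → Fin 4, ∃ c : ℂ, c ≠ 0 ∧ mcomm A B = c • pauliString s :=
    ⟨s, c, hc, h⟩
  obtain ⟨d, -, hd⟩ := hex.choose_spec
  rw [pbracket, dif_pos hex, eq_of_smul_pauliString_eq hc (h.symm.trans hd)]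

/-- Pauli strings whose factors multiply cyclically at the site `p` and commute elsewhere. -/
theorem mcomm_pauliString {N : ℕ} {s t r : Fin N → Fin 4} (p : Fin N)
    (hp : pauli (s p) * pauli (t p) = I • pauli (r p))
    (hp' : pauli (t p) * pauli (s p) = (-I) • pauli (r p))
    (h : ∀ k ≠ p, pauli (s k) * pauli (t k) = pauli (r k))
    (h' : ∀ k ≠ p, pauli (t k) * pauli (s k) = pauli (r k)) :
    mcomm (pauliString s) (pauliString t) = (2 * I) • pauliString r := by
  have key : ∀ (u v : Fin N → Fin 4) (c : ℂ), pauli (u p) * pauli (v p) = c • pauli (r p) →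
      (∀ k ≠ p, pauli (u k) * pauli (v k) = pauli (r k)) →
      pauliString u * pauliString v = c • pauliString r := by
    intro u v c hc hk
    have hfam : (fun k => pauli (u k) * pauli (v k)) =
        fun k => (if k = p then c else 1) • pauli (r k) := by
      funext k
      by_cases hkp : k = p
      · subst hkp
        simpa using hc
      · simpa [hkp] using hk k hkp
    rw [pauliString_eq_tensorFamily, pauliString_eq_tensorFamily, tensorFamily_mul, hfam,
      tensorFamily_smul, Finset.prod_ite_eq' Finset.univ p, if_pos (Finset.mem_univ p)]
    rfl
  rw [mcomm, key s t I hp h, key t s (-I) hp' h', ← sub_smul]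
  congr 1
  ring

theorem Accessible.pauliString_step {N : ℕ} {F M : Set (Mat N)} {s t r : Fin N → Fin 4} {c : ℂ}
    (hs : Accessible F M (pauliString s)) (ht : pauliString t ∈ F) (hc : c ≠ 0)
    (h : mcomm (pauliString s) (pauliString t) = c • pauliString r) :
    Accessible F M (pauliString r) := by
  rw [← pbracket_eq_pauliString hc h]
  exact hs.step ht (h ▸ smul_ne_zero hc (pauliString_ne_zero r))

theorem pauli_zero_mul (a : Fin 4) : pauli 0 * pauli a = pauli a := by simp [pauli]

theorem pauli_mul_zero (a : Fin 4) : pauli a * pauli 0 = pauli a := by simp [pauli]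

theorem pauli_two_mul_two : pauli 2 * pauli 2 = pauli 0 := by
  ext i j
  fin_cases i <;> fin_cases j <;> simp [pauli]

theorem pauli_three_mul_one : pauli 3 * pauli 1 = I • pauli 2 := by
  ext i j
  fin_cases i <;> fin_cases j <;> simp [pauli]

theorem pauli_one_mul_three : pauli 1 * pauli 3 = (-I) • pauli 2 := by
  ext i j
  fin_cases i <;> fin_cases j <;> simp [pauli]

theorem pauli_one_mul_two : pauli 1 * pauli 2 = I • pauli 3 := by
  ext i j
  fin_cases i <;> fin_cases j <;> simp [pauli]

theorem pauli_two_mul_one : pauli 2 * pauli 1 = (-I) • pauli 3 := by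
  ext i j
  fin_cases i <;> fin_cases j <;> simp [pauli]

/-- Index string of `Y_m X_{m+1}` (0-indexed). -/
def yxSite (N m : ℕ) : Fin N → Fin 4 :=
  fun j => if (j : ℕ) = m then 2 else if (j : ℕ) = m + 1 then 1 else 0

theorem mcomm_z_xx {N m : ℕ} (hm : m < N) :
    mcomm (pauliString (singleSite N m 3)) (pauliString (twoSite N m 1)) =
      (2 * I) • pauliString (yxSite N m) := by
  apply mcomm_pauliString ⟨m, hm⟩
  · simpa [singleSite, twoSite, yxSite] using pauli_three_mul_one
  · simpa [singleSite, twoSite, yxSite] using pauli_one_mul_three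
  all_goals
    intro k hk
    have hkm : (k : ℕ) ≠ m := fun h => hk (Fin.ext h)
    simp [singleSite, twoSite, yxSite, hkm, pauli_zero_mul, pauli_mul_zero]

theorem mcomm_yx_yy {N m : ℕ} (hm : m + 1 < N) :
    mcomm (pauliString (yxSite N m)) (pauliString (twoSite N m 2)) =
      (2 * I) • pauliString (singleSite N (m + 1) 3) := by
  apply mcomm_pauliString ⟨m + 1, hm⟩
  · simpa [singleSite, twoSite, yxSite] using pauli_one_mul_two
  · simpa [singleSite, twoSite, yxSite] using pauli_two_mul_one
  all_goals
    intro k hk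
    have hkm : (k : ℕ) ≠ m + 1 := fun h => hk (Fin.ext h)
    by_cases hk' : (k : ℕ) = m <;>
      simp [singleSite, twoSite, yxSite, hkm, hk', pauli_zero_mul, pauli_two_mul_two]

theorem accessible_singleSite_z {N : ℕ} (m : ℕ) (hm : m < N) :
    Accessible (chainF N) {pauliString (singleSite N 0 3)} (pauliString (singleSite N m 3)) := by
  induction m with
  | zero => exact .base rfl
  | succ m ih =>
    have h2 : (2 * I : ℂ) ≠ 0 := mul_ne_zero two_ne_zero I_ne_zero
    exact ((ih (by omega)).pauliString_step ⟨m, hm, .inl rfl⟩ h2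
      (mcomm_z_xx (by omega))).pauliString_step ⟨m, hm, .inr rfl⟩ h2 (mcomm_yx_yy hm)

theorem stmt_13 {N : ℕ} (hN : 1 ≤ N) (k : ℕ) (hk1 : 1 ≤ k) (hk2 : k ≤ N) :
    pauliString (singleSite N (k - 1) 3) ∈
      accSet (chainF N) {pauliString (singleSite N 0 3)} :=
  accessible_singleSite_z (k - 1) (by omega)
end
end
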